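/- Let α ≥ 0, M > 0, T > 0. Let u : ℝ² × [0,T] → ℝ be continuous, smooth on ℝ² × (0,T], and satisfy the heat equation ∂_t u = ∂²_x u + ∂²_y u on ℝ² × (0,T]. Assume |u(x,y,0)| ≤ M·exp(α·√(x²+y²)) for all (x,y) ∈ ℝ², and that u grows at most exponentially in space: there exist a, C > 0 with |u(x,y,t)| ≤ C·exp(a·√(x²+y²)) for all (x,y,t) ∈ ℝ²×[0,T]. Then |u(0,0,T)| ≤ (5π/2)·M·exp((1.1·α)²·T). -/

import Mathlib

lemma hc_second_test (f1 f1' f2 : ℝ → ℝ) (d x0 : ℝ) (h1 : ∀ x, HasDerivAt f1 (f1' x) x)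
    (h1' : HasDerivAt f1' d x0) (h2 : ContDiff ℝ 2 f2)
    (hmin : IsLocalMin (fun x => f1 x - f2 x) x0) : deriv (deriv f2) x0 ≤ d := by
  have hf2 : Differentiable ℝ f2 := h2.differentiable (by norm_num)
  have hf2' : Differentiable ℝ (deriv f2) := by
    have : ContDiff ℝ 1 (deriv f2) := ((contDiff_succ_iff_deriv (n := 1)).1 (by rw [one_add_one_eq_two]; exact h2)).2.2
    exact this.differentiable (by norm_num)
  have e1 : deriv (fun x => f1 x - f2 x) = fun x => f1' x - deriv f2 x := by
    funext x
    exact ((h1 x).sub (hf2 x).hasDerivAt).deriv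
  have e2 : deriv (deriv (fun x => f1 x - f2 x)) x0 = d - deriv (deriv f2) x0 := by
    rw [e1]
    exact (h1'.sub (hf2' x0).hasDerivAt).deriv
  by_contra! hlt
  have hneg : deriv (deriv (fun x => f1 x - f2 x)) x0 < 0 := by rw [e2]; linarith
  have hmax := isLocalMax_of_deriv_deriv_neg hneg hmin.deriv_eq_zero
    ((h1 x0).sub (hf2 x0).hasDerivAt).continuousAt
  have hconst : (fun x => f1 x - f2 x) =ᶠ[nhds x0] fun _ => f1 x0 - f2 x0 := by
    filter_upwards [hmin, hmax] with x ha hb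
    exact le_antisymm hb ha
  have h0 : deriv (deriv (fun x => f1 x - f2 x)) x0 = 0 := by
    rw [hconst.deriv.deriv_eq]
    simp
  linarith

lemma hc_time_test (f : ℝ → ℝ) (d t0 : ℝ) (ht : 0 < t0) (h : HasDerivAt f d t0)
    (hmin : ∀ t ∈ Set.Icc 0 t0, f t0 ≤ f t) : d ≤ 0 := by
  have hs := h.hasDerivWithinAt (s := Set.Iio t0)
  rw [hasDerivWithinAt_iff_tendsto_slope' (by simp)] at hs
  refine le_of_tendsto hs ?_
  filter_upwards [Ioo_mem_nhdsLT ht] with t htt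
  rw [slope_def_field]
  exact div_nonpos_of_nonneg_of_nonpos (by linarith [hmin t ⟨htt.1.le, htt.2.le⟩])
    (by linarith [htt.2])

lemma hc_cosh_deriv (p q x : ℝ) :
    HasDerivAt (fun x => Real.cosh (p * x + q)) (p * Real.sinh (p * x + q)) x := by
  have := ((((hasDerivAt_id x).const_mul p).add_const q)).cosh
  simpa [mul_comm] using this

lemma hc_sinh_deriv (p q x : ℝ) :
    HasDerivAt (fun x => Real.sinh (p * x + q)) (p * Real.cosh (p * x + q)) x := by
  have := ((((hasDerivAt_id x).const_mul p).add_const q)).sinh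
  simpa [mul_comm] using this

lemma hc_exp_cosh (z : ℝ) : Real.exp |z| ≤ 2 * Real.cosh z := by
  rw [← Real.cosh_abs, Real.cosh_eq]
  linarith [Real.exp_pos (-|z|)]

/-- four-term slice test -/
lemma hc_slice (A p1 q1 p2 q2 p3 q3 B p4 D : ℝ) (f2 : ℝ → ℝ) (x0 : ℝ) (h2 : ContDiff ℝ 2 f2)
    (hmin : IsLocalMin (fun x => (A * (Real.cosh (p1 * x + q1) + Real.cosh (p2 * x + q2)
      + Real.cosh (p3 * x + q3)) + B * Real.cosh (p4 * x + 0) + D) - f2 x) x0) :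
    deriv (deriv f2) x0 ≤ A * (p1 ^ 2 * Real.cosh (p1 * x0 + q1) + p2 ^ 2 * Real.cosh (p2 * x0 + q2)
      + p3 ^ 2 * Real.cosh (p3 * x0 + q3)) + B * (p4 ^ 2 * Real.cosh (p4 * x0 + 0)) := by
  refine hc_second_test _ _ f2 _ x0 (fun x => (((((hc_cosh_deriv p1 q1 x).add
    (hc_cosh_deriv p2 q2 x)).add (hc_cosh_deriv p3 q3 x)).const_mul A).add
    ((hc_cosh_deriv p4 0 x).const_mul B)).add_const D) ?_ h2 hmin
  have := ((((((hc_sinh_deriv p1 q1 x0).const_mul p1).add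
    ((hc_sinh_deriv p2 q2 x0).const_mul p2)).add ((hc_sinh_deriv p3 q3 x0).const_mul p3)).const_mul A).add
    (((hc_sinh_deriv p4 0 x0).const_mul p4).const_mul B))
  refine this.congr_deriv ?_
  ring

lemma hc_num (s : ℝ) (hs : 0 ≤ s) :
    Real.exp s ≤ 5 * Real.pi / 16 * (Real.exp (1.015 * s) + 6) := by
  have hpi := Real.pi_gt_d2
  have h1 : (0.98125 : ℝ) * (Real.exp (1.015 * s) + 6) ≤
      5 * Real.pi / 16 * (Real.exp (1.015 * s) + 6) := by
    apply mul_le_mul_of_nonneg_right (by linarith)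
    positivity
  refine le_trans ?_ h1
  have h2 : Real.exp (1.015 * s) = Real.exp s * Real.exp (0.015 * s) := by
    rw [← Real.exp_add]; congr 1; ring
  have h3 := Real.add_one_le_exp (0.015 * s)
  have hp := Real.exp_pos s
  rcases le_total s (3/2) with h | h
  · have h4 : Real.exp s ≤ 5 := by
      have : Real.exp s ≤ Real.exp (3/2) := Real.exp_le_exp.2 h
      have h5 : Real.exp (3/2) ^ 2 = Real.exp 1 ^ 3 := by
        rw [← Real.exp_nat_mul, ← Real.exp_nat_mul]; norm_num
      have h6 := Real.exp_one_lt_d9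
      have h7 : Real.exp 1 ^ 3 ≤ (2.72 : ℝ) ^ 3 := by
        apply pow_le_pow_left₀ (Real.exp_pos 1).le; linarith
      have h8 : Real.exp (3/2) ≤ 5 := by
        apply le_of_sq_le_sq _ (by norm_num)
        rw [h5]; norm_num at h7 ⊢; linarith
      linarith
    have := Real.exp_pos (1.015 * s)
    linarith
  · rw [h2]
    have : Real.exp s * 1.0225 ≤ Real.exp s * Real.exp (0.015 * s) :=
      mul_le_mul_of_nonneg_left (by linarith) hp.le
    linarith

lemma hc_init (α k x y : ℝ) (hα : 0 ≤ α) (hk : k ^ 2 = 1 / 2) (hk0 : 0 < k) :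
    Real.exp (α * Real.sqrt (x ^ 2 + y ^ 2)) ≤ 5 * Real.pi / 8 *
      (Real.cosh (1.1 * α * x) + Real.cosh (1.1 * α * y) + Real.cosh (1.1 * α * k * (x + y))
        + Real.cosh (1.1 * α * k * (x - y))) := by
  set r := Real.sqrt (x ^ 2 + y ^ 2) with hr
  have hr0 : 0 ≤ r := Real.sqrt_nonneg _
  have hr2 : r ^ 2 = x ^ 2 + y ^ 2 := Real.sq_sqrt (by positivity)
  have key : ∀ z : ℝ, (0.923 * r) ^ 2 ≤ z ^ 2 →
      Real.exp (1.015 * (α * r)) ≤ 2 * Real.cosh (1.1 * α * z) := by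
    intro z hz
    refine le_trans ?_ (hc_exp_cosh _)
    apply Real.exp_le_exp.2
    have h1 : 0.923 * r ≤ |z| := by
      have := sq_le_sq.1 hz
      rwa [abs_of_nonneg (by positivity)] at this
    rw [abs_mul, abs_of_nonneg (by positivity : 0 ≤ 1.1 * α)]
    have := mul_le_mul_of_nonneg_left h1 hα
    have h3 : 0 ≤ α * r := by positivity
    nlinarith
  have hn := hc_num (α * r) (by positivity)
  have c1 := Real.one_le_cosh (1.1 * α * x)
  have c2 := Real.one_le_cosh (1.1 * α * y)
  have c3 := Real.one_le_cosh (1.1 * α * k * (x + y))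
  have c4 := Real.one_le_cosh (1.1 * α * k * (x - y))
  have fin : Real.exp (1.015 * (α * r)) + 6 ≤ 2 *
      (Real.cosh (1.1 * α * x) + Real.cosh (1.1 * α * y) + Real.cosh (1.1 * α * k * (x + y))
        + Real.cosh (1.1 * α * k * (x - y))) := by
    by_cases h1 : (0.923 * r) ^ 2 ≤ x ^ 2
    · have := key _ h1; linarith
    by_cases h2 : (0.923 * r) ^ 2 ≤ y ^ 2
    · have := key _ h2; linarith
    by_cases h3 : (0.923 * r) ^ 2 ≤ (k * (x + y)) ^ 2
    · have := key _ h3; rw [← mul_assoc (1.1 * α) k] at this; linarith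
    by_cases h4 : (0.923 * r) ^ 2 ≤ (k * (x - y)) ^ 2
    · have := key _ h4; rw [← mul_assoc (1.1 * α) k] at this; linarith
    exfalso
    push Not at h1 h2 h3 h4
    rw [mul_pow, hr2] at h1 h2
    rw [mul_pow, mul_pow, hr2, hk] at h3 h4
    -- (x^2-y^2)^2 + (2xy)^2 = (x^2+y^2)^2
    have hS : 0 ≤ x ^ 2 + y ^ 2 := by positivity
    have a1 : (x ^ 2 - y ^ 2) ^ 2 ≤ (0.70386 * (x ^ 2 + y ^ 2)) ^ 2 :=
      sq_le_sq' (by nlinarith) (by nlinarith)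
    have a2 : (2 * x * y) ^ 2 ≤ (0.70386 * (x ^ 2 + y ^ 2)) ^ 2 :=
      sq_le_sq' (by nlinarith) (by nlinarith)
    have hS0 : 0 < x ^ 2 + y ^ 2 := by nlinarith
    have := pow_pos hS0 2
    nlinarith
  have hpi := Real.pi_pos
  have := mul_le_mul_of_nonneg_left fin (by positivity : 0 ≤ 5 * Real.pi / 16)
  linarith

lemma hc_core (α M T : ℝ) (hα : 0 ≤ α) (hM : 0 < M)
    (u : ℝ → ℝ → ℝ → ℝ)
    (hcont : ContinuousOn (fun p : ℝ × ℝ × ℝ => u p.1 p.2.1 p.2.2)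
      (Set.univ ×ˢ Set.univ ×ˢ Set.Icc 0 T))
    (hsx : ∀ y t, t ∈ Set.Ioo 0 T → ContDiff ℝ 2 (fun x => u x y t))
    (hsy : ∀ x t, t ∈ Set.Ioo 0 T → ContDiff ℝ 2 (fun y => u x y t))
    (hst : ∀ x y t, t ∈ Set.Ioo 0 T → DifferentiableAt ℝ (fun t => u x y t) t)
    (hheat : ∀ x y : ℝ, ∀ t ∈ Set.Ioo (0:ℝ) T,
      deriv (fun t' => u x y t') t
        = deriv (deriv (fun x' => u x' y t)) x + deriv (deriv (fun y' => u x y' t)) y)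
    (hinit : ∀ x y : ℝ, u x y 0 ≤ M * Real.exp (α * Real.sqrt (x ^ 2 + y ^ 2)))
    (a C : ℝ) (ha : 0 < a) (hC : 0 < C) (hgrowth : ∀ x y : ℝ, ∀ t ∈ Set.Icc (0:ℝ) T,
      u x y t ≤ C * Real.exp (a * Real.sqrt (x ^ 2 + y ^ 2)))
    (s : ℝ) (hs : s ∈ Set.Ioo 0 T) (ε : ℝ) (hε : 0 < ε) :
    u 0 0 s ≤ (5 * Real.pi / 2) * M * Real.exp ((1.1 * α) ^ 2 * s)
      + ε * (2 * Real.exp (((2 * a + 1) ^ 2 + 1) * s)) := by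
  obtain ⟨k, hk0, hk⟩ : ∃ k : ℝ, 0 < k ∧ k ^ 2 = 1 / 2 :=
    ⟨Real.sqrt (1/2), by positivity, Real.sq_sqrt (by norm_num)⟩
  set β := 1.1 * α with hβ
  set b := 2 * a + 1 with hb
  set A := 5 * Real.pi / 8 * M with hA
  have hpi := Real.pi_pos
  have hA0 : 0 < A := by positivity
  let Wp : ℝ → ℝ → ℝ := fun x y => Real.cosh (β * x) + Real.cosh (β * y)
    + Real.cosh (β * k * (x + y)) + Real.cosh (β * k * (x - y))
  let G : ℝ → ℝ → ℝ := fun x y => Real.cosh (b * x) + Real.cosh (b * y)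
  let ψ : ℝ → ℝ → ℝ → ℝ := fun x y t =>
    A * Real.exp (β ^ 2 * t) * Wp x y + ε * Real.exp ((b ^ 2 + 1) * t) * G x y
  have hWp : ∀ x y, 0 < Wp x y := fun x y => by
    have c1 := Real.cosh_pos (β * x)
    have c2 := Real.cosh_pos (β * y)
    have c3 := Real.cosh_pos (β * k * (x + y))
    have c4 := Real.cosh_pos (β * k * (x - y))
    simp only [Wp]; positivity
  have hG : ∀ x y, 0 < G x y := fun x y => by
    have c1 := Real.cosh_pos (b * x)
    have c2 := Real.cosh_pos (b * y)
    simp only [G]; positivity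
  by_contra! hlt
  have hneg : ψ 0 0 s - u 0 0 s < 0 := by
    have : ψ 0 0 s = (5 * Real.pi / 2) * M * Real.exp (β ^ 2 * s)
      + ε * (2 * Real.exp ((b ^ 2 + 1) * s)) := by
      simp only [ψ, Wp, G, hA]; norm_num; ring
    linarith
  set R := 2 * C / ε with hR
  have hR0 : 0 < R := by positivity
  -- positivity far away
  have hG1 : ∀ m z, R ≤ |m| → Real.cosh (b * m) ≤ z → C * Real.exp (2 * a * |m|) < ε * z := by
    intro m z hm hz
    have h1 := hc_exp_cosh (b * m)
    have hb0 : 0 < b := by positivity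
    rw [abs_mul, abs_of_pos hb0] at h1
    have h2 : Real.exp (b * |m|) = Real.exp (2 * a * |m|) * Real.exp |m| := by
      rw [← Real.exp_add]; congr 1; rw [hb]; ring
    have h3 := Real.add_one_le_exp |m|
    have h4 : R < Real.exp |m| := by linarith
    have h5 : 2 * C < ε * Real.exp |m| := by
      rw [hR, div_lt_iff₀ hε] at h4; linarith
    have h6 := mul_lt_mul_of_pos_left h5 (Real.exp_pos (2 * a * |m|))
    have h7 : ε * Real.exp (b * |m|) ≤ ε * (2 * z) :=
      mul_le_mul_of_nonneg_left (by linarith) hε.le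
    rw [h2] at h7
    linarith
  have hsq : ∀ m x y : ℝ, |x| ≤ m → |y| ≤ m → Real.sqrt (x ^ 2 + y ^ 2) ≤ 2 * m := by
    intro m x y hx hy
    have hm : 0 ≤ m := (abs_nonneg x).trans hx
    apply Real.sqrt_le_iff.2 ⟨by positivity, ?_⟩
    have := sq_le_sq' (by linarith [neg_abs_le x]) ((le_abs_self x).trans hx)
    have := sq_le_sq' (by linarith [neg_abs_le y]) ((le_abs_self y).trans hy)
    nlinarith
  have hψG : ∀ x y t, 0 ≤ t → ε * G x y < ψ x y t := by
    intro x y t ht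
    have h1 : 1 ≤ Real.exp ((b ^ 2 + 1) * t) := Real.one_le_exp (by positivity)
    have h2 : 0 < A * Real.exp (β ^ 2 * t) * Wp x y := by
      have := hWp x y; positivity
    have h3 : ε * G x y * 1 ≤ ε * G x y * Real.exp ((b ^ 2 + 1) * t) :=
      mul_le_mul_of_nonneg_left h1 (mul_pos hε (hG x y)).le
    simp only [ψ]
    linarith
  have hfar : ∀ x y t, t ∈ Set.Icc 0 T → (R ≤ |x| ∨ R ≤ |y|) → 0 < ψ x y t - u x y t := by
    intro x y t ht hxy
    have h1 := hgrowth x y t ht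
    have h2 := hψG x y t ht.1
    have hcx := Real.cosh_pos (b * x)
    have hcy := Real.cosh_pos (b * y)
    have : ∃ m, R ≤ |m| ∧ |x| ≤ |m| ∧ |y| ≤ |m| ∧ Real.cosh (b * m) ≤ G x y := by
      rcases le_total |x| |y| with h | h
      · exact ⟨y, by rcases hxy with h' | h' <;> linarith, h, le_rfl, by simp only [G]; linarith⟩
      · exact ⟨x, by rcases hxy with h' | h' <;> linarith, le_rfl, h, by simp only [G]; linarith⟩
    obtain ⟨m, hm1, hm2, hm3, hm4⟩ := this
    have h3 := hG1 m _ hm1 hm4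
    have h4 : C * Real.exp (a * Real.sqrt (x ^ 2 + y ^ 2)) ≤ C * Real.exp (2 * a * |m|) := by
      apply mul_le_mul_of_nonneg_left _ hC.le
      apply Real.exp_le_exp.2
      have := mul_le_mul_of_nonneg_left (hsq _ _ _ hm2 hm3) ha.le
      linarith
    linarith
  have hzero : ∀ x y, 0 < ψ x y 0 - u x y 0 := by
    intro x y
    have h1 := hinit x y
    have h2 := mul_le_mul_of_nonneg_left (hc_init α k x y hα hk hk0) hM.le
    have h3 : ψ x y 0 = A * Wp x y + ε * G x y := by simp [ψ]
    have h4 := mul_pos hε (hG x y)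
    rw [h3]
    rw [← hβ] at h2
    simp only [Wp, hA]
    linarith
  -- the minimum
  let K : Set (ℝ × ℝ × ℝ) := Set.Icc (-R) R ×ˢ Set.Icc (-R) R ×ˢ Set.Icc 0 s
  have hK : IsCompact K := isCompact_Icc.prod (isCompact_Icc.prod isCompact_Icc)
  have h0K : ((0, 0, s) : ℝ × ℝ × ℝ) ∈ K :=
    ⟨⟨by simp; positivity, by simp; positivity⟩, ⟨by simp; positivity, by simp; positivity⟩,
      ⟨hs.1.le, le_rfl⟩⟩
  have hzc : ContinuousOn (fun p : ℝ × ℝ × ℝ => ψ p.1 p.2.1 p.2.2 - u p.1 p.2.1 p.2.2) K := by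
    apply ContinuousOn.sub
    · apply Continuous.continuousOn
      simp only [ψ, Wp, G]
      have := Real.continuous_cosh
      fun_prop
    · apply hcont.mono
      rintro ⟨x, y, t⟩ ⟨_, _, h⟩
      exact ⟨trivial, trivial, h.1, h.2.trans hs.2.le⟩
  obtain ⟨⟨x, y, t⟩, hp, hmin⟩ := hK.exists_isMinOn ⟨_, h0K⟩ hzc
  have hmin' : ∀ x' y' t', |x'| ≤ R → |y'| ≤ R → t' ∈ Set.Icc 0 s →
      ψ x y t - u x y t ≤ ψ x' y' t' - u x' y' t' := fun x' y' t' h1 h2 h3 =>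
    hmin (show (x', y', t') ∈ K from ⟨abs_le.1 h1, abs_le.1 h2, h3⟩)
  have hpneg : ψ x y t - u x y t < 0 :=
    (hmin' 0 0 s (by simp; positivity) (by simp; positivity) ⟨hs.1.le, le_rfl⟩).trans_lt hneg
  have ht : t ∈ Set.Icc 0 s := hp.2.2
  have htT : t ∈ Set.Icc 0 T := ⟨ht.1, ht.2.trans hs.2.le⟩
  have hx : |x| < R := by
    by_contra! h; linarith [hfar x y t htT (Or.inl h)]
  have hy : |y| < R := by
    by_contra! h; linarith [hfar x y t htT (Or.inr h)]
  have ht0 : 0 < t := by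
    rcases ht.1.eq_or_lt with h | h
    · rw [← h] at hpneg; linarith [hzero x y]
    · exact h
  have htI : t ∈ Set.Ioo 0 T := ⟨ht0, ht.2.trans_lt hs.2⟩
  set E1 := A * Real.exp (β ^ 2 * t) with hE1
  set E2 := ε * Real.exp ((b ^ 2 + 1) * t) with hE2
  -- x slice
  have hX := hc_slice E1 β 0 (β * k) (β * k * y) (β * k) (-(β * k * y)) E2 b
    (E1 * Real.cosh (β * y) + E2 * Real.cosh (b * y)) (fun x' => u x' y t) x (hsx y t htI) (by
      have hn : ∀ᶠ x' in nhds x, |x'| < R := continuous_abs.continuousAt.eventually_lt_const hx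
      filter_upwards [hn] with x' hx'
      have := hmin' x' y t hx'.le hy.le ht
      simp only [ψ, Wp, G] at this
      rw [← hE1, ← hE2] at this
      ring_nf at this ⊢
      linarith)
  have hY := hc_slice E1 β 0 (β * k) (β * k * x) (-(β * k)) (β * k * x) E2 b
    (E1 * Real.cosh (β * x) + E2 * Real.cosh (b * x)) (fun y' => u x y' t) y (hsy x t htI) (by
      have hn : ∀ᶠ y' in nhds y, |y'| < R := continuous_abs.continuousAt.eventually_lt_const hy
      filter_upwards [hn] with y' hy'
      have := hmin' x y' t hx.le hy'.le ht
      simp only [ψ, Wp, G] at this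
      rw [← hE1, ← hE2] at this
      ring_nf at this ⊢
      linarith)
  have hTt : HasDerivAt (fun t' => ψ x y t' - u x y t')
      (β ^ 2 * E1 * Wp x y + (b ^ 2 + 1) * E2 * G x y - deriv (fun t' => u x y t') t) t := by
    have e1 : ∀ c : ℝ, HasDerivAt (fun t' => Real.exp (c * t')) (c * Real.exp (c * t)) t := by
      intro c
      have := ((hasDerivAt_id t).const_mul c).exp
      simpa [mul_comm] using this
    refine HasDerivAt.sub ?_ (hst x y t htI).hasDerivAt
    refine ((((e1 (β ^ 2)).const_mul A).mul_const (Wp x y)).add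
      (((e1 (b ^ 2 + 1)).const_mul ε).mul_const (G x y))).congr_deriv ?_
    rw [hE1, hE2]; ring
  have hTd := hc_time_test _ _ t ht0 hTt (fun t' ht' =>
    hmin' x y t' hx.le hy.le ⟨ht'.1, ht'.2.trans ht.2⟩)
  rw [hheat x y t htI] at hTd
  have hE2G : 0 < E2 * G x y := mul_pos (by positivity) (hG x y)
  have r1 : β * k * x + β * k * y = β * k * (x + y) := by ring
  have r2 : β * k * x + -(β * k * y) = β * k * (x - y) := by ring
  have r3 : β * k * y + β * k * x = β * k * (x + y) := by ring
  have r4 : -(β * k) * y + β * k * x = β * k * (x - y) := by ring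
  rw [r1, r2, add_zero, add_zero, mul_pow β k, hk] at hX
  rw [r3, r4, add_zero, add_zero, neg_sq, mul_pow β k, hk] at hY
  simp only [Wp, G] at hTd hE2G
  linarith

/-- Heat-equation estimate on `ℝ²`: if `u` solves the heat equation on
`ℝ² × (0,T]`, is continuous up to `t = 0`, satisfies
`|u(·,·,0)| ≤ M·exp(α·√(x²+y²))` and grows at most exponentially in space,
then `|u(0,0,T)| ≤ (5π/2)·M·exp((1.1α)²·T)`. -/
theorem heat_comparison_estimate (α M T : ℝ) (hα : 0 ≤ α) (hM : 0 < M) (hT : 0 < T)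
    (u : ℝ → ℝ → ℝ → ℝ)
    (hcont : ContinuousOn (fun p : ℝ × ℝ × ℝ => u p.1 p.2.1 p.2.2)
      (Set.univ ×ˢ Set.univ ×ˢ Set.Icc 0 T))
    (hsmooth : ContDiffOn ℝ (⊤ : ℕ∞) (fun p : ℝ × ℝ × ℝ => u p.1 p.2.1 p.2.2)
      (Set.univ ×ˢ Set.univ ×ˢ Set.Ioc 0 T))
    (hheat : ∀ x y : ℝ, ∀ t ∈ Set.Ioc (0:ℝ) T,
      deriv (fun t' => u x y t') t
        = deriv (deriv (fun x' => u x' y t)) x + deriv (deriv (fun y' => u x y' t)) y)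
    (hinit : ∀ x y : ℝ, |u x y 0| ≤ M * Real.exp (α * Real.sqrt (x ^ 2 + y ^ 2)))
    (hgrowth : ∃ a C : ℝ, 0 < a ∧ 0 < C ∧ ∀ x y : ℝ, ∀ t ∈ Set.Icc (0:ℝ) T,
      |u x y t| ≤ C * Real.exp (a * Real.sqrt (x ^ 2 + y ^ 2))) :
    |u 0 0 T| ≤ (5 * Real.pi / 2) * M * Real.exp ((1.1 * α) ^ 2 * T) := by
  obtain ⟨a, C, ha, hC, hg⟩ := hgrowth
  have hsx : ∀ y t, t ∈ Set.Ioo 0 T → ContDiff ℝ 2 (fun x => u x y t) := by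
    intro y t ht
    rw [← contDiffOn_univ]
    exact (hsmooth.of_le (WithTop.coe_le_coe.2 (le_top : (2:ℕ∞) ≤ ⊤))).comp
      (f := fun x : ℝ => (x, y, t)) (by fun_prop)
      (fun x _ => ⟨trivial, trivial, ht.1, ht.2.le⟩)
  have hsy : ∀ x t, t ∈ Set.Ioo 0 T → ContDiff ℝ 2 (fun y => u x y t) := by
    intro x t ht
    rw [← contDiffOn_univ]
    exact (hsmooth.of_le (WithTop.coe_le_coe.2 (le_top : (2:ℕ∞) ≤ ⊤))).comp
      (f := fun y : ℝ => (x, y, t)) (by fun_prop)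
      (fun x _ => ⟨trivial, trivial, ht.1, ht.2.le⟩)
  have hst : ∀ x y t, t ∈ Set.Ioo 0 T → DifferentiableAt ℝ (fun t => u x y t) t := by
    intro x y t ht
    have h1 : ContDiffOn ℝ 1 (fun t => u x y t) (Set.Ioc 0 T) :=
      (hsmooth.of_le (by exact_mod_cast le_top)).comp
        (f := fun t : ℝ => (x, y, t)) (by fun_prop) (fun t ht => ⟨trivial, trivial, ht⟩)
    exact (h1.contDiffAt (Ioc_mem_nhds ht.1 ht.2)).differentiableAt (by norm_num)
  have hIoo : ∀ s ∈ Set.Ioo 0 T,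
      |u 0 0 s| ≤ (5 * Real.pi / 2) * M * Real.exp ((1.1 * α) ^ 2 * s) := by
    intro s hs
    have lim : ∀ v B : ℝ, (∀ ε > 0, v ≤ B + ε * (2 * Real.exp (((2 * a + 1) ^ 2 + 1) * s))) →
        v ≤ B := by
      intro v B h
      apply le_of_forall_pos_le_add
      intro δ hδ
      have hpos : 0 < 2 * Real.exp (((2 * a + 1) ^ 2 + 1) * s) := by positivity
      have := h (δ / (2 * Real.exp (((2 * a + 1) ^ 2 + 1) * s))) (by positivity)
      rwa [div_mul_cancel₀ _ hpos.ne'] at this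
    apply abs_le'.2
    constructor
    · apply lim
      intro ε hε
      exact hc_core α M T hα hM u hcont hsx hsy hst
        (fun x y t ht => hheat x y t ⟨ht.1, ht.2.le⟩)
        (fun x y => (le_abs_self _).trans (hinit x y)) a C ha hC
        (fun x y t ht => (le_abs_self _).trans (hg x y t ht)) s hs ε hε
    · apply lim
      intro ε hε
      refine hc_core α M T hα hM (fun x y t => - u x y t) hcont.neg
        (fun y t ht => (hsx y t ht).neg) (fun x t ht => (hsy x t ht).neg)
        (fun x y t ht => (hst x y t ht).neg) ?_
        (fun x y => (neg_le_abs _).trans (hinit x y)) a C ha hC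
        (fun x y t ht => (neg_le_abs _).trans (hg x y t ht)) s hs ε hε
      intro x y t ht
      have := hheat x y t ⟨ht.1, ht.2.le⟩
      have n1 : ∀ f : ℝ → ℝ, deriv (fun z => - f z) = fun z => - deriv f z := by
        intro f; funext z; exact deriv.fun_neg
      simp only [n1]
      rw [this]; ring
  have hc1 : ContinuousWithinAt (fun s => |u 0 0 s|) (Set.Iio T) T := by
    have h1 : ContinuousOn (fun t => u 0 0 t) (Set.Icc 0 T) :=
      hcont.comp (f := fun t : ℝ => ((0:ℝ), (0:ℝ), t)) (by fun_prop)
        (fun t ht => ⟨trivial, trivial, ht⟩)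
    have h2 := (h1 T ⟨hT.le, le_rfl⟩).abs
    refine (h2.mono Set.Ico_subset_Icc_self).mono_of_mem_nhdsWithin ?_
    exact Ico_mem_nhdsLT hT
  have hc2 : ContinuousWithinAt
      (fun s => (5 * Real.pi / 2) * M * Real.exp ((1.1 * α) ^ 2 * s)) (Set.Iio T) T := by
    apply Continuous.continuousWithinAt
    fun_prop
  refine le_of_tendsto_of_tendsto hc1 hc2 ?_
  filter_upwards [Ioo_mem_nhdsLT hT] with s hs
  exact hIoo s hs
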